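/- Let 0 ≤ α < 1 and let f(z) = z·h(z)·conj(g(z)) belong to S*_Lh(α) with h(z) = exp(Σ_{n≥1} aₙ zⁿ) and g(z) = exp(Σ_{n≥1} bₙ zⁿ). If 0 ≤ r < 1 satisfies (r/(1−r)^{2α})·exp(4(1−α)r/(1−r)) ≤ 1/(2^{2α}·e^{2(1−α)}), then r·exp(Σ_{n≥1} (|aₙ| + |bₙ|) rⁿ) ≤ d(0, ∂(f(𝔻))). -/

import Mathlib

open Complex Metric

namespace Bohr

def kap (n : ℕ) : ℂ := if n = 0 then 1 else 2

lemma int_exp (k : ℤ) : ∫ x in (0:ℝ)..(2*Real.pi), cexp (k * (x * I)) = if k = 0 then (2*Real.pi : ℂ) else 0 := by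
  split_ifs with hk
  · subst hk; simp
  · have h1 : (k * I : ℂ) ≠ 0 := by simp [hk]
    have := integral_exp_mul_complex (a := 0) (b := 2*Real.pi) h1
    have h2 : ∀ x : ℝ, cexp (k * (x * I)) = cexp (k * I * x) := fun x => by ring_nf
    simp_rw [h2, this]
    have h3 : (k * I * ((2 * Real.pi : ℝ) : ℂ)) = k * (2 * Real.pi * I) := by push_cast; ring
    rw [h3, Complex.exp_int_mul_two_pi_mul_I]
    simp

/-- Fourier coefficients of the real part. -/
lemma coef_int (Q : ℕ → ℂ) (hQ : Summable fun n => ‖Q n‖) (h0 : Q 0 = 1) (n : ℕ) :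
    kap n * ∫ x in (0:ℝ)..(2*Real.pi), (((∑' j, Q j * cexp (x * I) ^ j).re : ℝ) : ℂ) * cexp (-(x * I)) ^ n
      = 2 * Real.pi * Q n := by
  have e1 : ∀ x : ℝ, ‖cexp (x * I)‖ = 1 := fun x => Complex.norm_exp_ofReal_mul_I x
  have e2 : ∀ x : ℝ, ‖cexp (-(x * I))‖ = 1 := fun x => by
    have := Complex.norm_exp_ofReal_mul_I (-x); push_cast at this; rwa [neg_mul] at this
  have key : HasSum (fun j => ∫ x in (0:ℝ)..(2*Real.pi),
      (Q j * cexp (x * I) ^ j + (starRingEnd ℂ) (Q j) * cexp (-(x * I)) ^ j) / 2 * cexp (-(x * I)) ^ n)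
      (∫ x in (0:ℝ)..(2*Real.pi), (((∑' j, Q j * cexp (x * I) ^ j).re : ℝ) : ℂ) * cexp (-(x * I)) ^ n) := by
    apply intervalIntegral.hasSum_integral_of_dominated_convergence (fun j _ => ‖Q j‖)
    · intro j
      apply Continuous.aestronglyMeasurable
      fun_prop
    · intro j
      refine Filter.Eventually.of_forall fun x _ => ?_
      rw [norm_mul, norm_pow, e2, one_pow, mul_one, norm_div]
      have : ‖Q j * cexp (x * I) ^ j + (starRingEnd ℂ) (Q j) * cexp (-(x * I)) ^ j‖ ≤ ‖Q j‖ + ‖Q j‖ := by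
        refine (norm_add_le _ _).trans (le_of_eq ?_)
        simp [e1, e2]
      simp only [RCLike.norm_ofNat]
      linarith
    · exact Filter.Eventually.of_forall fun x _ => hQ
    · exact intervalIntegrable_const
    · refine Filter.Eventually.of_forall fun x _ => ?_
      apply HasSum.mul_right
      have hs : Summable fun j => Q j * cexp (x * I) ^ j := by
        apply Summable.of_norm; simpa [e1] using hQ
      have h1 := hs.hasSum
      have h2 := h1.map (starRingEnd ℂ) Complex.continuous_conj
      have h3 := (h1.add h2).div_const 2
      rw [Complex.re_eq_add_conj]
      convert h3 using 1
      · rfl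
      funext j
      simp only [Function.comp, map_mul, map_pow, ← Complex.exp_conj, Complex.conj_ofReal, Complex.conj_I, mul_neg]
  have ev : ∀ j : ℕ, ∫ x in (0:ℝ)..(2*Real.pi),
      (Q j * cexp (x * I) ^ j + (starRingEnd ℂ) (Q j) * cexp (-(x * I)) ^ j) / 2 * cexp (-(x * I)) ^ n
      = Q j / 2 * (if ((j:ℤ) - n) = 0 then (2*Real.pi : ℂ) else 0)
        + (starRingEnd ℂ) (Q j) / 2 * (if (-(j:ℤ) - n) = 0 then (2*Real.pi : ℂ) else 0) := by
    intro j
    rw [← int_exp, ← int_exp, ← intervalIntegral.integral_const_mul, ← intervalIntegral.integral_const_mul,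
      ← intervalIntegral.integral_add]
    · congr 1; ext x
      have f1 : cexp (((j:ℤ) - n : ℤ) * (x * I)) = cexp (x * I) ^ j * cexp (-(x * I)) ^ n := by
        rw [← Complex.exp_nat_mul, ← Complex.exp_nat_mul, ← Complex.exp_add]; push_cast; ring_nf
      have f2 : cexp ((-(j:ℤ) - n : ℤ) * (x * I)) = cexp (-(x * I)) ^ j * cexp (-(x * I)) ^ n := by
        rw [← Complex.exp_nat_mul, ← Complex.exp_nat_mul, ← Complex.exp_add]; push_cast; ring_nf
      rw [f1, f2]; ring
    · apply Continuous.intervalIntegrable; fun_prop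
    · apply Continuous.intervalIntegrable; fun_prop
  simp_rw [ev] at key
  have key2 := hasSum_single (f := fun j : ℕ => Q j / 2 * (if ((j:ℤ) - n) = 0 then (2*Real.pi : ℂ) else 0)
        + (starRingEnd ℂ) (Q j) / 2 * (if (-(j:ℤ) - n) = 0 then (2*Real.pi : ℂ) else 0)) n (by
      intro j hj
      have h1 : ¬ ((j:ℤ) - n = 0) := by omega
      have h2 : ¬ (-(j:ℤ) - n = 0) := by omega
      simp only [h1, h2]; simp)
  rw [key.unique key2]
  by_cases hn : n = 0
  · subst hn; simp [kap, h0]; ring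
  · have h2 : ¬ (-(n:ℤ) - n = 0) := by omega
    simp only [h2, kap, hn]; simp; ring

lemma lemH (Q t : ℕ → ℂ) (hQ : Summable fun n => ‖Q n‖) (h0 : Q 0 = 1)
    (hpos : ∀ ζ : ℂ, ‖ζ‖ = 1 → 0 ≤ (∑' j, Q j * ζ ^ j).re)
    (ht : Summable fun n => ‖t n‖) (C : ℝ)
    (hC : ∀ ζ : ℂ, ‖ζ‖ = 1 → C ≤ (∑' j, kap j * t j * ζ ^ j).re) :
    C ≤ (∑' j, Q j * t j).re := by
  have e1 : ∀ x : ℝ, ‖cexp (x * I)‖ = 1 := fun x => Complex.norm_exp_ofReal_mul_I x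
  have e2 : ∀ x : ℝ, ‖cexp (-(x * I))‖ = 1 := fun x => by
    have := Complex.norm_exp_ofReal_mul_I (-x); push_cast at this; rwa [neg_mul] at this
  set w : ℝ → ℝ := fun x => (∑' j, Q j * cexp (x * I) ^ j).re with hw
  have hwc : Continuous w := by
    refine Complex.continuous_re.comp ?_
    apply continuous_tsum (u := fun j => ‖Q j‖) _ hQ
    · intro n x; simp [e1]
    · intro i; fun_prop
  have hkap : ∀ n, ‖kap n‖ ≤ 2 := by intro n; unfold kap; split_ifs <;> simp
  have hkt : Summable fun n => ‖kap n * t n‖ := by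
    refine Summable.of_nonneg_of_le (fun _ => norm_nonneg _) (fun n => ?_) (ht.mul_left 2)
    rw [norm_mul]; gcongr; exact hkap n
  set T : ℝ → ℂ := fun x => ∑' j, kap j * t j * cexp (-(x * I)) ^ j with hT
  have hTc : Continuous T := by
    apply continuous_tsum (u := fun j => ‖kap j * t j‖) _ hkt
    · intro n x; rw [norm_mul, norm_pow, e2]; simp
    · intro i; fun_prop
  have hwb : ∀ x, |w x| ≤ ∑' j, ‖Q j‖ := by
    intro x
    refine (Complex.abs_re_le_norm _).trans ?_
    apply tsum_of_norm_bounded hQ.hasSum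
    intro j; simp [e1]
  have key : HasSum (fun j => ∫ x in (0:ℝ)..(2*Real.pi), (w x : ℂ) * (kap j * t j * cexp (-(x * I)) ^ j))
      (∫ x in (0:ℝ)..(2*Real.pi), (w x : ℂ) * T x) := by
    apply intervalIntegral.hasSum_integral_of_dominated_convergence (fun j _ => (∑' j, ‖Q j‖) * ‖kap j * t j‖)
    · intro j
      apply Continuous.aestronglyMeasurable
      fun_prop
    · intro j
      refine Filter.Eventually.of_forall fun x _ => ?_
      rw [norm_mul, norm_mul (kap j * t j), norm_pow, e2, one_pow, mul_one]
      gcongr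
      simpa using hwb x
    · exact Filter.Eventually.of_forall fun x _ => hkt.mul_left _
    · exact intervalIntegrable_const
    · refine Filter.Eventually.of_forall fun x _ => ?_
      apply HasSum.mul_left
      apply Summable.hasSum
      apply Summable.of_norm
      simpa [e2] using hkt
  have ev : ∀ j, ∫ x in (0:ℝ)..(2*Real.pi), (w x : ℂ) * (kap j * t j * cexp (-(x * I)) ^ j)
      = 2 * Real.pi * (Q j * t j) := by
    intro j
    have := coef_int Q hQ h0 j
    calc _ = t j * (kap j * ∫ x in (0:ℝ)..(2*Real.pi), (w x : ℂ) * cexp (-(x * I)) ^ j) := by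
          rw [← intervalIntegral.integral_const_mul, ← intervalIntegral.integral_const_mul]
          congr 1; ext x; ring
      _ = _ := by rw [this]; ring
  simp_rw [ev] at key
  have hsum : ∫ x in (0:ℝ)..(2*Real.pi), (w x : ℂ) * T x = 2 * Real.pi * ∑' j, Q j * t j := by
    rw [← key.tsum_eq, tsum_mul_left]
  have hw1 : ∫ x in (0:ℝ)..(2*Real.pi), (w x : ℂ) = 2 * Real.pi := by
    have := coef_int Q hQ h0 0
    simpa [kap, h0] using this
  have hw2 : ∫ x in (0:ℝ)..(2*Real.pi), w x = 2 * Real.pi := by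
    rw [intervalIntegral.integral_ofReal] at hw1
    exact_mod_cast hw1
  have hre : ∫ x in (0:ℝ)..(2*Real.pi), w x * (T x).re = 2 * Real.pi * (∑' j, Q j * t j).re := by
    have h1 : IntervalIntegrable (fun x => (w x : ℂ) * T x) MeasureTheory.volume 0 (2*Real.pi) := by
      apply Continuous.intervalIntegrable; fun_prop
    have := Complex.reCLM.intervalIntegral_comp_comm h1
    rw [hsum] at this
    simpa using this
  have hmono : ∫ x in (0:ℝ)..(2*Real.pi), w x * C ≤ ∫ x in (0:ℝ)..(2*Real.pi), w x * (T x).re := by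
    apply intervalIntegral.integral_mono_on (by positivity)
    · apply Continuous.intervalIntegrable; fun_prop
    · apply Continuous.intervalIntegrable; fun_prop
    · intro x _
      exact mul_le_mul_of_nonneg_left (hC _ (e2 x)) (hpos _ (e1 x))
  rw [hre, intervalIntegral.integral_mul_const, hw2] at hmono
  exact le_of_mul_le_mul_left hmono (by positivity)

lemma coef_le_two (Q : ℕ → ℂ) (hQ : Summable fun n => ‖Q n‖) (h0 : Q 0 = 1)
    (hpos : ∀ ζ : ℂ, ‖ζ‖ = 1 → 0 ≤ (∑' j, Q j * ζ ^ j).re) (n : ℕ) (hn : n ≠ 0) : ‖Q n‖ ≤ 2 := by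
  by_cases hz : Q n = 0
  · simp [hz]
  have hz' : (‖Q n‖ : ℂ) ≠ 0 := by simpa using hz
  set c : ℂ := -((starRingEnd ℂ) (Q n) / ‖Q n‖) with hc
  have hcn : ‖c‖ = 1 := by simp [hc, hz]
  have := lemH Q (Pi.single n c) hQ h0 hpos (by
    apply summable_of_ne_finset_zero (s := {n})
    intro b hb; simp at hb; simp [hb]) (-2) (by
    intro ζ hζ
    rw [tsum_eq_single n (by intro j hj; simp [hj])]
    have h1 : ‖kap n * (Pi.single n c : ℕ → ℂ) n * ζ ^ n‖ = 2 := by simp [kap, hn, hcn, hζ]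
    have := Complex.abs_re_le_norm (kap n * (Pi.single n c : ℕ → ℂ) n * ζ ^ n)
    rw [h1] at this
    exact (abs_le.1 this).1)
  rw [tsum_eq_single n (by intro j hj; simp [hj])] at this
  have h2 : Q n * (Pi.single n c : ℕ → ℂ) n = -(‖Q n‖ : ℂ) := by
    simp only [Pi.single_eq_same, hc]
    have : Q n * (starRingEnd ℂ) (Q n) = ‖Q n‖ ^ 2 := Complex.mul_conj' _
    field_simp
    rw [← this]
  rw [h2] at this
  simp at this
  linarith

lemma kap_sum (a b : ℂ) (n : ℕ) :
    ∑ p ∈ Finset.HasAntidiagonal.antidiagonal (n+1), kap p.1 * kap p.2 * (a ^ p.1 * b ^ p.2)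
      = 2 * (a + b) * ∑ i ∈ Finset.range (n+1), a ^ i * b ^ (n - i) := by
  rw [Finset.Nat.sum_antidiagonal_eq_sum_range_succ (fun i j => kap i * kap j * (a ^ i * b ^ j))]
  have h1 : (a) * ∑ i ∈ Finset.range (n+1), a ^ i * b ^ (n - i)
      = a ^ (n+1) + ∑ i ∈ Finset.range n, a ^ (i+1) * b ^ (n - i) := by
    rw [Finset.sum_range_succ, mul_add, add_comm, Finset.mul_sum]
    congr 1
    · simp [pow_succ]; ring
    · exact Finset.sum_congr rfl fun i _ => by rw [pow_succ]; ring
  have h2 : (b) * ∑ i ∈ Finset.range (n+1), a ^ i * b ^ (n - i)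
      = b ^ (n+1) + ∑ i ∈ Finset.range n, a ^ (i+1) * b ^ (n - i) := by
    rw [Finset.sum_range_succ', mul_add, add_comm, Finset.mul_sum]
    congr 1
    · simp [pow_succ]; ring
    · refine Finset.sum_congr rfl fun i hi => ?_
      have : n - i = (n - (i+1)) + 1 := by simp at hi; omega
      rw [this, pow_succ]; ring
  rw [mul_assoc, add_mul, h1, h2, Finset.sum_range_succ, Finset.sum_range_succ']
  have h3 : ∑ k ∈ Finset.range n, kap (k + 1) * kap (n + 1 - (k + 1)) * (a ^ (k + 1) * b ^ (n + 1 - (k + 1)))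
      = 4 * ∑ i ∈ Finset.range n, a ^ (i+1) * b ^ (n - i) := by
    rw [Finset.mul_sum]
    refine Finset.sum_congr rfl fun i hi => ?_
    have h4 : n + 1 - (i + 1) = n - i := by omega
    have h5 : n - i ≠ 0 := by simp at hi; omega
    rw [h4]; simp only [kap, h5, Nat.succ_ne_zero, if_false]; ring
  rw [h3]; simp [kap]; ring

lemma arg_mono (ρ : ℝ) (h0 : 0 ≤ ρ) (h1 : ρ < 1) :
    Antitone fun x : ℝ => (Complex.log (1 - ρ * cexp (x * I))).im - x / 2 := by
  have hn : ∀ x : ℝ, ‖(ρ:ℂ) * cexp (x * I)‖ < 1 := fun x => by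
    rw [norm_mul, Complex.norm_exp_ofReal_mul_I]; simpa [abs_of_nonneg h0] using h1
  have hd : ∀ x : ℝ, HasDerivAt (fun x : ℝ => (Complex.log (1 - ρ * cexp (x * I))).im - x / 2)
      ((-(ρ * (cexp (x * I) * I)) / (1 - ρ * cexp (x * I))).im - 1 / 2) x := by
    intro x
    have e1 : HasDerivAt (fun x : ℝ => cexp (x * I)) (cexp (x * I) * I) x := by
      have := ((hasDerivAt_id x).ofReal_comp.mul_const I).cexp
      simpa using this
    have e2 : HasDerivAt (fun x : ℝ => 1 - ρ * cexp (x * I)) (-(ρ * (cexp (x * I) * I))) x := by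
      simpa using (e1.const_mul (ρ:ℂ)).const_sub 1
    have e3 := e2.clog_real (Complex.mem_slitPlane_of_norm_lt_one (z := -(ρ * cexp (x*I))) (by rw [norm_neg]; exact hn x))
    have e4 := (Complex.imCLM.hasFDerivAt.comp_hasDerivAt x e3)
    exact e4.sub ((hasDerivAt_id x).div_const 2)
  apply antitone_of_deriv_nonpos (fun x => (hd x).differentiableAt)
  intro x
  rw [(hd x).deriv]
  set w : ℂ := ρ * cexp (x * I) with hw
  have hw1 := hn x
  rw [← hw] at hw1
  have : -(ρ * (cexp (x * I) * I)) / (1 - w) = -(w / (1 - w)) * I := by rw [hw]; ring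
  rw [this]
  have hne : 1 - w ≠ 0 := by
    intro h; have : w = 1 := by linear_combination -h
    rw [this] at hw1; simp at hw1
  have h3 : 0 < normSq (1 - w) := Complex.normSq_pos.2 hne
  have h4 : normSq w < 1 := by rw [Complex.normSq_eq_norm_sq]; nlinarith [norm_nonneg w]
  have : (-(w / (1 - w)) * I).im = - (w / (1-w)).re := by simp
  rw [this, Complex.div_re]
  rw [Complex.normSq_apply] at h3 h4 
  rw [Complex.normSq_apply]
  simp only [sub_re, one_re, sub_im, one_im] at *
  rw [← add_div, ← neg_div, sub_nonpos, div_le_iff₀ h3]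
  nlinarith

lemma re_ge_half (w : ℂ) (hw1 : ‖w‖ < 1) : -1/2 ≤ (w / (1 - w)).re := by
  have hne : 1 - w ≠ 0 := by
    intro h; have : w = 1 := by linear_combination -h
    rw [this] at hw1; simp at hw1
  have h3 : 0 < normSq (1 - w) := Complex.normSq_pos.2 hne
  have h4 : normSq w < 1 := by rw [Complex.normSq_eq_norm_sq]; nlinarith [norm_nonneg w]
  rw [Complex.div_re]
  rw [Complex.normSq_apply] at h3 h4 
  rw [Complex.normSq_apply]
  simp only [sub_re, one_re, sub_im, one_im] at *
  rw [← add_div, le_div_iff₀ h3]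
  nlinarith

lemma kernel_aux (ρ x y : ℝ) (h0 : 0 ≤ ρ) (h1 : ρ < 1) (hxy : y < x) (hxy2 : x ≤ y + Real.pi) (a b : ℂ)
    (ha : a = ρ * cexp (x * I)) (hb : b = ρ * cexp (y * I)) (hab : a ≠ b) :
    -2 ≤ (2 * (a + b) / (a - b) * (-Complex.log (1 - a) - -Complex.log (1 - b))).re := by
  set δ := (x - y) / 2 with hδ
  have hδ0 : 0 < δ := by rw [hδ]; linarith
  have hδ1 : δ ≤ Real.pi / 2 := by rw [hδ]; linarith
  have hs : 0 < Real.sin δ := Real.sin_pos_of_pos_of_lt_pi hδ0 (by linarith [Real.pi_pos])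
  have hc : 0 ≤ Real.cos δ := Real.cos_nonneg_of_mem_Icc ⟨by linarith, hδ1⟩
  have hsc : (Real.sin δ : ℂ) ≠ 0 := by exact_mod_cast hs.ne'
  set c : ℂ := ρ * cexp (((x + y) / 2 : ℝ) * I) with hcdef
  have ea : a = c * (Real.cos δ + Real.sin δ * I) := by
    rw [ha, hcdef, mul_assoc, Complex.ofReal_cos, Complex.ofReal_sin, ← Complex.exp_mul_I, ← Complex.exp_add]
    congr 2; rw [hδ]; push_cast; ring
  have eb : b = c * (Real.cos δ - Real.sin δ * I) := by
    have : (Real.cos δ - Real.sin δ * I : ℂ) = cexp ((-δ : ℝ) * I) := by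
      rw [Complex.exp_mul_I, ← Complex.ofReal_cos, ← Complex.ofReal_sin]; simp; ring
    rw [this, hb, hcdef, mul_assoc, ← Complex.exp_add]
    congr 2; rw [hδ]; push_cast; ring
  have hc0 : c ≠ 0 := by
    rintro h; apply hab; rw [ea, eb, h]; simp
  have eC : 2 * (a + b) / (a - b) = ((-2 * (Real.cos δ / Real.sin δ) : ℝ) : ℂ) * I := by
    have : a - b = 2 * c * Real.sin δ * I := by rw [ea, eb]; ring
    rw [this, div_eq_iff (by simp [hc0, hs.ne', -Complex.ofReal_sin])]
    rw [ea, eb]; push_cast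
    rw [← Complex.ofReal_sin] at *
    field_simp
    ring_nf
    simp [Complex.I_sq]
  rw [eC]
  have hm := arg_mono ρ h0 h1 hxy.le
  simp only [← ha, ← hb] at hm
  set A := (Complex.log (1-a)).im
  set B := (Complex.log (1-b)).im
  have hre : ∀ (k : ℝ) (w : ℂ), ((k:ℂ) * I * w).re = - k * w.im := by intro k w; simp
  rw [hre]
  simp only [sub_im, neg_im]
  change -2 ≤ -(-2 * (Real.cos δ / Real.sin δ)) * (-A - -B)
  have hAB : A - B ≤ δ := by rw [hδ]; linarith
  have hcot : δ * Real.cos δ ≤ Real.sin δ := by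
    rcases hδ1.eq_or_lt with h | h
    · rw [h]; simp
    · have := Real.le_tan hδ0.le h
      have hcp : 0 < Real.cos δ := Real.cos_pos_of_mem_Ioo ⟨by linarith, h⟩
      rwa [Real.tan_eq_sin_div_cos, le_div_iff₀ hcp] at this
  have h5 : (Real.cos δ / Real.sin δ) * (A - B) ≤ 1 := by
    calc _ ≤ (Real.cos δ / Real.sin δ) * δ := by gcongr
      _ ≤ 1 := by rw [div_mul_eq_mul_div, div_le_one hs]; linarith
  linarith

lemma kernel_aux2 (a b : ℂ) (hab : ‖a‖ = ‖b‖) (hb : ‖b‖ < 1) (hne : a ≠ b) :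
    -2 ≤ (2 * (a + b) / (a - b) * (-Complex.log (1 - a) - -Complex.log (1 - b))).re := by
  have hb0 : b ≠ 0 := by
    rintro rfl; apply hne; simpa using hab
  have ha0 : a ≠ 0 := by
    rintro rfl; apply hb0; simpa using hab.symm
  have main : ∀ a b : ℂ, ‖a‖ = ‖b‖ → ‖b‖ < 1 → a ≠ b → a ≠ 0 → b ≠ 0 → 0 ≤ arg (a / b) →
     -2 ≤ (2 * (a + b) / (a - b) * (-Complex.log (1 - a) - -Complex.log (1 - b))).re := by
    intro a b hab hb hne ha0 hb0 harg
    have eb : b = (‖b‖ : ℝ) * cexp (arg b * I) := (Complex.norm_mul_exp_arg_mul_I b).symm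
    have eab : a / b = cexp (arg (a/b) * I) := by
      have := (Complex.norm_mul_exp_arg_mul_I (a/b)).symm
      rw [norm_div, hab, div_self (by simpa using hb0)] at this
      simpa using this
    have ea : a = (‖b‖ : ℝ) * cexp ((arg b + arg (a/b) : ℝ) * I) := by
      have : a = b * (a / b) := by field_simp
      conv_lhs => rw [this, eab]
      conv_lhs => enter [1]; rw [eb]
      rw [mul_assoc, ← Complex.exp_add]; push_cast; ring_nf
    refine kernel_aux ‖b‖ (arg b + arg (a/b)) (arg b) (norm_nonneg _) hb ?_ ?_ a b ea eb hne
    · rcases harg.eq_or_lt with h | h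
      · exfalso; apply hne
        rw [← h] at eab; simp at eab; field_simp at eab; exact eab
      · linarith
    · linarith [Complex.arg_le_pi (a/b)]
  by_cases harg : 0 ≤ arg (a/b)
  · exact main a b hab hb hne ha0 hb0 harg
  · have : 0 ≤ arg (b / a) := by
      have h1 : b / a = (a / b)⁻¹ := by simp
      rw [h1, Complex.arg_inv]; split_ifs
      · exact Real.pi_pos.le
      · linarith
    have := main b a hab.symm (hab ▸ hb) hne.symm hb0 ha0 this
    convert this using 2
    have h1 : a - b ≠ 0 := sub_ne_zero.2 hne
    have h2 : b - a ≠ 0 := sub_ne_zero.2 hne.symm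
    field_simp; ring

lemma kernel (a b : ℂ) (hab : ‖a‖ = ‖b‖) (hb : ‖b‖ < 1) :
    -2 ≤ (∑' n : ℕ, (∑ p ∈ Finset.HasAntidiagonal.antidiagonal n, kap p.1 * kap p.2 * (a ^ p.1 * b ^ p.2)) / n).re := by
  by_cases hne : a = b
  · subst hne
    have : ∀ n : ℕ, (∑ p ∈ Finset.HasAntidiagonal.antidiagonal n, kap p.1 * kap p.2 * (a ^ p.1 * a ^ p.2)) / n
       = 4 * (if n = 0 then 0 else a ^ n) := by
      rintro (_ | n)
      · simp
      · rw [kap_sum]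
        have : ∑ i ∈ Finset.range (n+1), a ^ i * a ^ (n - i) = (n+1) * a ^ n := by
          rw [Finset.sum_congr rfl (g := fun _ => a ^ n)]
          · simp
          · intro i hi; rw [← pow_add]; congr 1; simp at hi; omega
        rw [this]
        have h3 : ((n:ℂ)+1) ≠ 0 := by exact_mod_cast Nat.succ_ne_zero n
        push_cast
        field_simp; ring
    simp_rw [this]
    rw [tsum_mul_left]
    have h2 : HasSum (fun n : ℕ => if n = 0 then 0 else a ^ n) (a / (1 - a)) := by
      rw [← hasSum_nat_add_iff' 1]
      simpa [pow_succ, div_eq_inv_mul] using (hasSum_geometric_of_norm_lt_one hb).mul_right a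
    rw [h2.tsum_eq]
    have := re_ge_half a hb
    simp only [mul_re, re_ofNat, im_ofNat, zero_mul, sub_zero]
    linarith
  · have h1 : a - b ≠ 0 := sub_ne_zero.2 hne
    have : ∀ n : ℕ, (∑ p ∈ Finset.HasAntidiagonal.antidiagonal n, kap p.1 * kap p.2 * (a ^ p.1 * b ^ p.2)) / n
       = 2 * (a + b) / (a - b) * (a ^ n / n - b ^ n / n) := by
      rintro (_ | n)
      · simp
      · rw [kap_sum]
        have := (Commute.all a b).geom_sum₂_mul (n+1)
        simp only [Nat.add_sub_cancel] at this
        rw [← sub_div, ← this]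
        field_simp
    simp_rw [this]
    have h2 := ((Complex.hasSum_taylorSeries_neg_log (hab ▸ hb : ‖a‖ < 1)).sub (Complex.hasSum_taylorSeries_neg_log hb)).mul_left (2 * (a + b) / (a - b))
    rw [h2.tsum_eq]
    exact kernel_aux2 a b hab hb hne


lemma hs_congr {f g : ℕ → ℂ} {s : ℂ} (h : HasSum f s) (e : ∀ n, g n = f n) : HasSum g s := by
  rw [show g = f from funext e]; exact h

lemma kap_le (n : ℕ) : ‖kap n‖ ≤ 2 := by unfold kap; split_ifs <;> simp

lemma tsum_anti (F : ℕ → ℕ → ℂ) (hF : Summable fun p : ℕ × ℕ => F p.1 p.2) :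
    ∑' n : ℕ, ∑ p ∈ Finset.HasAntidiagonal.antidiagonal n, F p.1 p.2 = ∑' j, ∑' k, F j k := by
  rw [← hF.tsum_prod]
  have e := Finset.HasAntidiagonal.sigmaAntidiagonalEquivProd (A := ℕ)
  rw [← (Finset.HasAntidiagonal.sigmaAntidiagonalEquivProd (A := ℕ)).tsum_eq]
  have h2 := (Finset.HasAntidiagonal.sigmaAntidiagonalEquivProd (A := ℕ)).summable_iff.2 hF
  refine Eq.trans ?_ (Summable.tsum_sigma h2).symm
  congr 1; ext n
  rw [tsum_fintype, ← Finset.sum_coe_sort]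
  rfl

noncomputable def EE (z : ℂ) (j k : ℕ) : ℂ := z ^ (j + k) / ((j + k : ℕ) : ℂ)

lemma EE_le (z : ℂ) (j k : ℕ) : ‖EE z j k‖ ≤ ‖z‖ ^ j * ‖z‖ ^ k := by
  unfold EE
  rw [norm_div, norm_pow, pow_add]
  rcases Nat.eq_zero_or_pos (j + k) with h | h
  · rw [h]; simp; positivity
  · apply div_le_self (by positivity)
    rw [Complex.norm_natCast]; exact_mod_cast h

lemma summ2 (z : ℂ) (hz : ‖z‖ < 1) (x y : ℕ → ℂ) (hx : ∀ n, ‖x n‖ ≤ 2) (hy : ∀ n, ‖y n‖ ≤ 2) :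
    Summable fun p : ℕ × ℕ => x p.1 * y p.2 * EE z p.1 p.2 := by
  have hg := summable_geometric_of_lt_one (norm_nonneg z) hz
  have h := (hg.mul_of_nonneg hg (fun n => by positivity) (fun n => by positivity)).mul_left 4
  refine Summable.of_norm_bounded h fun p => ?_
  rw [norm_mul, norm_mul]
  calc _ ≤ 2 * 2 * (‖z‖ ^ p.1 * ‖z‖ ^ p.2) := by
        gcongr
        · exact hx _
        · exact hy _
        · exact EE_le _ _ _
    _ = _ := by ring

lemma summ1 (z : ℂ) (hz : ‖z‖ < 1) (y : ℕ → ℂ) (hy : ∀ n, ‖y n‖ ≤ 2) (j : ℕ) :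
    Summable (fun k => y k * EE z j k) ∧ ‖∑' k, y k * EE z j k‖ ≤ ‖z‖ ^ j * (2 * (1 - ‖z‖)⁻¹) := by
  have hg := ((hasSum_geometric_of_lt_one (norm_nonneg z) hz).mul_left 2).mul_left (‖z‖ ^ j)
  have : ∀ k, ‖y k * EE z j k‖ ≤ ‖z‖ ^ j * (2 * ‖z‖ ^ k) := by
    intro k
    rw [norm_mul]
    calc _ ≤ 2 * (‖z‖ ^ j * ‖z‖ ^ k) := by
          gcongr
          · exact hy _
          · exact EE_le _ _ _
      _ = _ := by ring
  exact ⟨Summable.of_norm_bounded hg.summable this, tsum_of_norm_bounded hg this⟩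

lemma EE_symm (z : ℂ) (j k : ℕ) : EE z j k = EE z k j := by unfold EE; rw [add_comm]

lemma summ1' (z : ℂ) (hz : ‖z‖ < 1) (y : ℕ → ℂ) (hy : ∀ n, ‖y n‖ ≤ 2) :
    Summable fun j => ‖∑' k, y k * EE z j k‖ :=
  Summable.of_nonneg_of_le (fun _ => norm_nonneg _) (fun j => (summ1 z hz y hy j).2)
    ((summable_geometric_of_lt_one (norm_nonneg z) hz).mul_right _)

lemma lemII (Q S : ℕ → ℂ) (hQ : Summable fun n => ‖Q n‖) (hQ0 : Q 0 = 1)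
    (hQpos : ∀ ζ : ℂ, ‖ζ‖ = 1 → 0 ≤ (∑' j, Q j * ζ ^ j).re)
    (hS : Summable fun n => ‖S n‖) (hS0 : S 0 = 1)
    (hSpos : ∀ ζ : ℂ, ‖ζ‖ = 1 → 0 ≤ (∑' j, S j * ζ ^ j).re) (z : ℂ) (hz : ‖z‖ < 1) :
    -2 ≤ (∑' n : ℕ, (∑ p ∈ Finset.HasAntidiagonal.antidiagonal n, Q p.1 * S p.2) * (z ^ n / n)).re := by
  have hQ2 : ∀ n, ‖Q n‖ ≤ 2 := by
    intro n; by_cases hn : n = 0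
    · subst hn; simp [hQ0]
    · exact coef_le_two Q hQ hQ0 hQpos n hn
  have hS2 : ∀ n, ‖S n‖ ≤ 2 := by
    intro n; by_cases hn : n = 0
    · subst hn; simp [hS0]
    · exact coef_le_two S hS hS0 hSpos n hn
  have conv : ∀ x y : ℕ → ℂ, (∀ n, ‖x n‖ ≤ 2) → (∀ n, ‖y n‖ ≤ 2) →
      ∑' n : ℕ, (∑ p ∈ Finset.HasAntidiagonal.antidiagonal n, x p.1 * y p.2) * (z ^ n / n)
        = ∑' j, x j * ∑' k, y k * EE z j k := by
    intro x y hx hy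
    have h := tsum_anti (fun j k => x j * y k * EE z j k) (summ2 z hz x y hx hy)
    calc _ = ∑' n : ℕ, ∑ p ∈ Finset.HasAntidiagonal.antidiagonal n, x p.1 * y p.2 * EE z p.1 p.2 := by
          congr 1; ext n
          rw [Finset.sum_mul]
          refine Finset.sum_congr rfl fun p hp => ?_
          rw [EE, Finset.HasAntidiagonal.mem_antidiagonal.1 hp]
      _ = _ := by
          rw [h]; congr 1; ext j
          rw [← tsum_mul_left]; congr 1; ext k; ring
  have swap : ∀ x y : ℕ → ℂ, (∀ n, ‖x n‖ ≤ 2) → (∀ n, ‖y n‖ ≤ 2) →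
      ∑' j, x j * ∑' k, y k * EE z j k = ∑' k, y k * ∑' j, x j * EE z k j := by
    intro x y hx hy
    have h := Summable.tsum_comm (f := fun j k => x j * y k * EE z j k) (summ2 z hz x y hx hy)
    calc _ = ∑' j, ∑' k, x j * y k * EE z j k := by
          congr 1; ext j
          rw [← tsum_mul_left]; congr 1; ext k; ring
      _ = _ := by
          rw [← h]
          congr 1; ext j
          rw [← tsum_mul_left]; congr 1; ext k; rw [EE_symm]; ring
  have hkz : ∀ ζ : ℂ, ‖ζ‖ = 1 → ∀ n, ‖kap n * ζ ^ n‖ ≤ 2 := by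
    intro ζ hζ n; simpa [hζ] using kap_le n
  rw [conv Q S hQ2 hS2]
  apply lemH Q _ hQ hQ0 hQpos (summ1' z hz S hS2)
  intro ζ hζ
  have e1 : ∑' j, kap j * (∑' k, S k * EE z j k) * ζ ^ j
      = ∑' k, S k * ∑' j, (kap j * ζ ^ j) * EE z k j := by
    rw [← swap _ S (hkz ζ hζ) hS2]
    congr 1; ext j; ring
  rw [e1]
  apply lemH S _ hS hS0 hSpos (summ1' z hz _ (hkz ζ hζ))
  intro ξ hξ
  have e2 : ∑' k, kap k * (∑' j, (kap j * ζ ^ j) * EE z k j) * ξ ^ k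
      = ∑' n : ℕ, (∑ p ∈ Finset.HasAntidiagonal.antidiagonal n, kap p.1 * kap p.2 * ((ξ * z) ^ p.1 * (ζ * z) ^ p.2)) / n := by
    calc _ = ∑' k, (kap k * ξ ^ k) * (∑' j, (kap j * ζ ^ j) * EE z k j) := by
            congr 1; ext j; ring
      _ = _ := by
            rw [← conv _ _ (hkz ξ hξ) (hkz ζ hζ)]
            congr 1; ext n
            rw [Finset.sum_mul, Finset.sum_div]
            refine Finset.sum_congr rfl fun p hp => ?_
            rw [← Finset.HasAntidiagonal.mem_antidiagonal.1 hp]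
            push_cast
            ring
  rw [e2]
  apply kernel
  · simp [hξ, hζ]
  · simpa [hζ] using hz

lemma lemI (S : ℕ → ℂ)
    (hS : Summable fun n => ‖S n‖) (hS0 : S 0 = 1)
    (hSpos : ∀ ζ : ℂ, ‖ζ‖ = 1 → 0 ≤ (∑' j, S j * ζ ^ j).re) (z : ℂ) (hz : ‖z‖ < 1) :
    -2 * Real.log 2 ≤ (∑' n : ℕ, S n * (z ^ n / n)).re := by
  apply lemH S _ hS hS0 hSpos
  · exact (Complex.hasSum_taylorSeries_neg_log hz).summable.norm
  intro ζ hζ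
  have hz2 : ‖ζ * z‖ < 1 := by simpa [hζ] using hz
  have h1 := (Complex.hasSum_taylorSeries_neg_log hz2).mul_left 2
  have : ∀ n : ℕ, kap n * (z ^ n / n) * ζ ^ n = 2 * ((ζ * z) ^ n / n) := by
    rintro (_ | n)
    · simp
    · simp [kap]; ring
  simp_rw [this]
  rw [h1.tsum_eq]
  simp only [mul_re, re_ofNat, im_ofNat, zero_mul, sub_zero, neg_re, Complex.log_re]
  have hne : 1 - ζ * z ≠ 0 := by
    intro h; have : ζ * z = 1 := by linear_combination -h
    rw [this] at hz2; simp at hz2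
  have : Real.log ‖1 - ζ * z‖ ≤ Real.log 2 := by
    apply Real.log_le_log (norm_pos_iff.2 hne)
    refine (norm_sub_le _ _).trans ?_
    simp only [norm_one]; linarith
  linarith

/-- power series on the unit disk -/
def PS (F : ℂ → ℂ) (c : ℕ → ℂ) : Prop := ∀ z ∈ ball (0:ℂ) 1, HasSum (fun n => c n * z ^ n) (F z)

lemma PS.exists {F : ℂ → ℂ} (hF : DifferentiableOn ℂ F (ball 0 1)) : ∃ c, PS F c := by
  refine ⟨fun n => (n.factorial : ℂ)⁻¹ * iteratedDeriv n F 0, fun z hz => ?_⟩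
  have := Complex.hasSum_taylorSeries_on_ball hF hz
  refine hs_congr this fun n => ?_
  simp; ring

lemma PS.summable {F c} (h : PS F c) {z : ℂ} (hz : z ∈ ball (0:ℂ) 1) : Summable fun n => ‖c n * z ^ n‖ :=
  (h z hz).summable.norm

lemma PS.unique {F c d} (h : PS F c) (h' : PS F d) : c = d := by
  have key : ∀ c, PS F c → HasFPowerSeriesAt F (FormalMultilinearSeries.ofScalars ℂ c) 0 := by
    intro c h
    rw [hasFPowerSeriesAt_iff]
    filter_upwards [ball_mem_nhds (0:ℂ) one_pos] with z hz
    have := h z hz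
    simpa [mul_comm] using this
  have := (key c h).eq_formalMultilinearSeries (key d h')
  exact FormalMultilinearSeries.ofScalars_series_injective ℂ ℂ this

lemma PS.add {F G c d} (h : PS F c) (h' : PS G d) : PS (fun z => F z + G z) (fun n => c n + d n) := by
  intro z hz
  simpa [add_mul] using (h z hz).add (h' z hz)

lemma PS.sub {F G c d} (h : PS F c) (h' : PS G d) : PS (fun z => F z - G z) (fun n => c n - d n) := by
  intro z hz
  simpa [sub_mul] using (h z hz).sub (h' z hz)

lemma PS.mul {F G c d} (h : PS F c) (h' : PS G d) : PS (fun z => F z * G z)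
    (fun n => ∑ p ∈ Finset.HasAntidiagonal.antidiagonal n, c p.1 * d p.2) := by
  intro z hz
  have h1 := h.summable hz
  have h2 := h'.summable hz
  have h3 := tsum_mul_tsum_eq_tsum_sum_antidiagonal_of_summable_norm h1 h2
  have h4 := (summable_norm_sum_mul_antidiagonal_of_summable_norm h1 h2).of_norm.hasSum
  rw [← h3, (h z hz).tsum_eq, (h' z hz).tsum_eq] at h4
  refine hs_congr h4 fun n => ?_
  rw [Finset.sum_mul]
  refine Finset.sum_congr rfl fun p hp => ?_
  rw [← Finset.HasAntidiagonal.mem_antidiagonal.1 hp]; ring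

lemma PS.const_mul {F c} (k : ℂ) (h : PS F c) : PS (fun z => k * F z) (fun n => k * c n) := by
  intro z hz
  simpa [mul_assoc] using (h z hz).mul_left k

lemma PS.zero_eq {F c} (h : PS F c) : F 0 = c 0 := by
  have := h 0 (by simp)
  refine this.unique ?_
  convert hasSum_single 0 ?_ using 1
  · simp
  · intro n hn; simp [hn]

lemma PS.const (k : ℂ) : PS (fun _ => k) (fun n => if n = 0 then k else 0) := by
  intro z hz
  convert hasSum_single (0:ℕ) ?_ using 1
  · simp
  · intro n hn; simp [hn]

lemma PS.zderiv {F c} (h : PS F c) : DifferentiableOn ℂ F (ball 0 1) ∧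
    PS (fun z => z * deriv F z) (fun n => n * c n) := by
  have hloc : ∀ z ∈ ball (0:ℂ) 1, DifferentiableAt ℂ F z ∧ HasSum (fun n => n * c n * z ^ n) (z * deriv F z) := by
    intro z hz
    have hz1 : ‖z‖ < 1 := by simpa using hz
    obtain ⟨R, hR1, hR2⟩ := exists_between hz1
    have hR0 : 0 < R := (norm_nonneg z).trans_lt hR1
    have hRb : (R:ℂ) ∈ ball (0:ℂ) 1 := by simpa [abs_of_pos hR0] using hR2
    have hu := h.summable hRb
    have hzR : z ∈ ball (0:ℂ) R := by simpa using hR1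
    have hd : ∀ i : ℕ, DifferentiableOn ℂ (fun w => c i * w ^ i) (ball 0 R) := fun i => by fun_prop
    have hb : ∀ (i : ℕ) (w : ℂ), w ∈ ball (0:ℂ) R → ‖c i * w ^ i‖ ≤ ‖c i * (R:ℂ) ^ i‖ := by
      intro i w hw
      have : ‖w‖ < R := by simpa using hw
      simp only [norm_mul, norm_pow, norm_real, Real.norm_eq_abs, abs_of_pos hR0]
      gcongr
    have h1 := Complex.differentiableOn_tsum_of_summable_norm hu hd isOpen_ball hb
    have h2 := Complex.hasSum_deriv_of_summable_norm hu hd isOpen_ball hb hzR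
    have heq : Set.EqOn (fun w => ∑' i, c i * w ^ i) F (ball 0 R) := by
      intro w hw
      exact (h w (ball_subset_ball hR2.le hw)).tsum_eq
    have hev := heq.eventuallyEq_of_mem (isOpen_ball.mem_nhds hzR)
    refine ⟨((h1 z hzR).differentiableAt (isOpen_ball.mem_nhds hzR)).congr_of_eventuallyEq hev.symm, ?_⟩
    rw [← hev.deriv_eq]
    refine hs_congr (h2.mul_left z) fun n => ?_
    rcases n with _ | n
    · simp
    · rw [deriv_const_mul_field, deriv_pow_field, Nat.add_sub_cancel, pow_succ]; ring
  exact ⟨fun z hz => (hloc z hz).1.differentiableWithinAt, fun z hz => (hloc z hz).2⟩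

/-- scaling to closed disk -/
lemma PS.scale {F c} (h : PS F c) (hpos : ∀ z ∈ ball (0:ℂ) 1, 0 < (F z).re) (R : ℝ) (hR0 : 0 ≤ R) (hR : R < 1) :
    (Summable fun n => ‖c n * (R:ℂ) ^ n‖) ∧ ∀ ζ : ℂ, ‖ζ‖ = 1 → 0 ≤ (∑' j, (c j * (R:ℂ) ^ j) * ζ ^ j).re := by
  have hRb : (R:ℂ) ∈ ball (0:ℂ) 1 := by simpa [abs_of_nonneg hR0] using hR
  refine ⟨h.summable hRb, fun ζ hζ => ?_⟩
  have hRz : (R * ζ:ℂ) ∈ ball (0:ℂ) 1 := by simpa [abs_of_nonneg hR0, hζ] using hR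
  have := (h _ hRz).tsum_eq
  simp only [mul_pow, ← mul_assoc] at this
  rw [this]; exact (hpos _ hRz).le

lemma PS.coef_le {F c} (h : PS F c) (hpos : ∀ z ∈ ball (0:ℂ) 1, 0 < (F z).re) (h0 : F 0 = 1) (n : ℕ)
    (hn : n ≠ 0) : ‖c n‖ ≤ 2 := by
  have hc0 : c 0 = 1 := by rw [← h.zero_eq, h0]
  have hev : ∀ᶠ R : ℝ in nhdsWithin 1 (Set.Iio 1), ‖c n‖ * R ^ n ≤ 2 := by
    filter_upwards [Ioo_mem_nhdsLT (show (0:ℝ) < 1 by norm_num)] with R hR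
    obtain ⟨h1, h2⟩ := h.scale hpos R hR.1.le hR.2
    have := coef_le_two _ h1 (by simp [hc0]) h2 n hn
    simpa [abs_of_pos hR.1] using this
  have ht : Filter.Tendsto (fun R : ℝ => ‖c n‖ * R ^ n) (nhdsWithin 1 (Set.Iio 1)) (nhds (‖c n‖ * 1 ^ n)) :=
    (Continuous.tendsto (by fun_prop) 1).mono_left nhdsWithin_le_nhds
  simpa using le_of_tendsto ht hev

lemma PS.summ_div {F c} (h : PS F c) {z : ℂ} (hz : z ∈ ball (0:ℂ) 1) : Summable fun n : ℕ => c n * (z ^ n / n) := by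
  refine Summable.of_norm_bounded (h.summable hz) fun n => ?_
  rw [norm_mul, norm_mul, norm_div]
  gcongr
  rcases Nat.eq_zero_or_pos n with h | h
  · subst h; simp
  · apply div_le_self (by positivity)
    rw [Complex.norm_natCast]; exact_mod_cast h

lemma core (α : ℝ) (hα0 : 0 ≤ α) (hα1 : α < 1) (A B : ℂ → ℂ) (a b : ℕ → ℂ) (ha0 : a 0 = 0) (hb0 : b 0 = 0)
    (hA : PS A (fun n => n * a n)) (hB : PS B (fun n => n * b n))
    (hAB : ∀ z ∈ ball (0:ℂ) 1, ‖B z‖ < ‖1 + A z‖)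
    (hst : ∀ z ∈ ball (0:ℂ) 1, α < (1 + A z - B z).re) :
    (∀ n : ℕ, n ≠ 0 → n * (‖a n‖ + ‖b n‖) ≤ 4 * (1 - α) * n + 2 * α) ∧
    (∀ z ∈ ball (0:ℂ) 1, -2 * (1 - α) - 2 * α * Real.log 2 ≤ (∑' n, (a n + b n) * z ^ n).re) := by
  have h1α : (0:ℝ) < 1 - α := by linarith
  have h1αc : (1 - α : ℂ) ≠ 0 := by exact_mod_cast h1α.ne'
  have hAd := hA.zderiv.1
  have hBd := hB.zderiv.1
  have hA0 : A 0 = 0 := by simpa using hA.zero_eq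
  have hB0 : B 0 = 0 := by simpa using hB.zero_eq
  set p : ℂ → ℂ := fun z => 1 + A z - B z with hp
  have hpd : DifferentiableOn ℂ p (ball 0 1) := ((differentiableOn_const 1).add hAd).sub hBd
  have hpne : ∀ z ∈ ball (0:ℂ) 1, p z ≠ 0 := by
    intro z hz h
    have := hst z hz
    change α < (p z).re at this
    rw [h] at this; simp at this; linarith
  set q : ℂ → ℂ := fun z => (p z - α) / (1 - α) with hq
  have hqd : DifferentiableOn ℂ q (ball 0 1) := (hpd.sub_const _).div_const _
  set s : ℂ → ℂ := fun z => (1 + A z + B z) / p z with hs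
  have hsd : DifferentiableOn ℂ s (ball 0 1) := (((differentiableOn_const 1).add hAd).add hBd).div hpd hpne
  have hqpos : ∀ z ∈ ball (0:ℂ) 1, 0 < (q z).re := by
    intro z hz
    have h1 : q z = (p z - α) / ((1 - α : ℝ) : ℂ) := by rw [hq]; push_cast; rfl
    rw [h1, Complex.div_ofReal_re]
    apply div_pos _ h1α
    have := hst z hz
    simp only [sub_re, ofReal_re]
    change α < (p z).re at this
    linarith
  have hspos : ∀ z ∈ ball (0:ℂ) 1, 0 < (s z).re := by
    intro z hz
    have h1 := hAB z hz
    have h2 : normSq (B z) < normSq (1 + A z) := by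
      rw [Complex.normSq_eq_norm_sq, Complex.normSq_eq_norm_sq]
      have := norm_nonneg (B z)
      nlinarith
    have h3 : 0 < normSq (p z) := Complex.normSq_pos.2 (hpne z hz)
    rw [hs]
    simp only
    rw [Complex.div_re, ← add_div]
    apply div_pos _ h3
    rw [Complex.normSq_apply, Complex.normSq_apply] at h2
    simp only [hp, add_re, sub_re, add_im, sub_im, one_re, one_im] at *
    nlinarith
  have hq0 : q 0 = 1 := by
    simp only [hq, hp, hA0, hB0]; simp [h1αc]
  have hs0 : s 0 = 1 := by simp only [hs, hp, hA0, hB0]; simp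
  obtain ⟨qc, hqc⟩ := PS.exists hqd
  obtain ⟨sc, hsc⟩ := PS.exists hsd
  have hqc0 : qc 0 = 1 := by rw [← hqc.zero_eq, hq0]
  have hsc0 : sc 0 = 1 := by rw [← hsc.zero_eq, hs0]
  have hpc1 : PS p _ := ((PS.const 1).add hA).sub hB
  have hpc2 : PS p (fun n => (if n = 0 then (α:ℂ) else 0) + (1 - α) * qc n) := by
    have := (PS.const (α:ℂ)).add (hqc.const_mul (1 - α))
    have e : p = fun z => α + (1 - α) * q z := by
      funext z; simp only [hq]; field_simp; ring
    rw [e]; exact this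
  have hps1 : PS (fun z => 1 + A z + B z) _ := ((PS.const 1).add hA).add hB
  set pc : ℕ → ℂ := fun n => (if n = 0 then (α:ℂ) else 0) + (1 - α) * qc n with hpc
  have hps2 : PS (fun z => 1 + A z + B z) (fun n => ∑ p ∈ Finset.HasAntidiagonal.antidiagonal n, pc p.1 * sc p.2) := by
    intro z hz
    have := (hpc2.mul hsc) z hz
    have e : p z * s z = 1 + A z + B z := by
      simp only [hs]; field_simp [hpne z hz]
    change HasSum _ (p z * s z) at this
    rw [e] at this; exact this
  have E1 := hpc1.unique hpc2
  have E2 := hps1.unique hps2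
  have E1' : ∀ n : ℕ, n ≠ 0 → n * a n - n * b n = pc n := by
    intro n hn
    have := congrFun E1 n
    simpa only [hn, if_false, zero_add] using this
  have E2' : ∀ n : ℕ, n ≠ 0 → n * a n + n * b n = ∑ p ∈ Finset.HasAntidiagonal.antidiagonal n, pc p.1 * sc p.2 := by
    intro n hn
    have := congrFun E2 n
    simpa only [hn, if_false, zero_add] using this
  have hsc2 : ∀ n, n ≠ 0 → ‖sc n‖ ≤ 2 := fun n hn => hsc.coef_le hspos hs0 n hn
  have hqc2 : ∀ n, n ≠ 0 → ‖qc n‖ ≤ 2 := fun n hn => hqc.coef_le hqpos hq0 n hn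
  have hpc0 : pc 0 = 1 := by simp [hpc, hqc0]
  have hpcn : ∀ n, n ≠ 0 → ‖pc n‖ ≤ 2 * (1 - α) := by
    intro n hn
    simp only [hpc, hn, if_false, zero_add, norm_mul]
    have : ‖(1 - α : ℂ)‖ = 1 - α := by
      rw [← Complex.ofReal_one, ← Complex.ofReal_sub, Complex.norm_real, Real.norm_eq_abs, abs_of_pos h1α]
    rw [this]
    nlinarith [hqc2 n hn]
  constructor
  · intro n hn
    have e1 := E1' n hn
    have e2 := E2' n hn
    rw [Finset.Nat.sum_antidiagonal_eq_sum_range_succ (fun i j => pc i * sc j), Finset.sum_range_succ] at e2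
    simp only [Nat.sub_self, hsc0, mul_one] at e2
    set N := ∑ k ∈ Finset.range n, pc k * sc (n - k) with hN
    have hNb : ‖N‖ ≤ 2 * (1 + (n - 1) * (2 * (1 - α))) := by
      obtain ⟨m, rfl⟩ := Nat.exists_eq_succ_of_ne_zero hn
      refine (norm_sum_le _ _).trans ?_
      rw [Finset.sum_range_succ']
      have t1 : ‖pc 0 * sc (m.succ - 0)‖ ≤ 2 := by
        rw [hpc0, one_mul]; exact hsc2 _ (by simp)
      have t2 : ∑ k ∈ Finset.range m, ‖pc (k+1) * sc (m.succ - (k+1))‖ ≤ ∑ k ∈ Finset.range m, (2 * (1 - α) * 2) := by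
        apply Finset.sum_le_sum
        intro k hk
        rw [norm_mul]
        have hk' := Finset.mem_range.1 hk
        gcongr
        · exact hpcn _ (by simp)
        · exact hsc2 _ (by simp; omega)
      rw [Finset.sum_const, Finset.card_range, nsmul_eq_mul] at t2
      rw [Nat.cast_succ]
      linarith
    have ea : (n:ℂ) * a n = pc n + N / 2 := by linear_combination e1 / 2 + e2 / 2
    have eb : (n:ℂ) * b n = N / 2 := by linear_combination e2 / 2 - e1 / 2
    have na : n * ‖a n‖ ≤ 2 * (1 - α) + ‖N‖ / 2 := by
      have : n * ‖a n‖ = ‖(n:ℂ) * a n‖ := by simp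
      rw [this, ea]
      refine (norm_add_le _ _).trans ?_
      rw [norm_div]
      simp only [RCLike.norm_ofNat]
      linarith [hpcn n hn]
    have nb : n * ‖b n‖ = ‖N‖ / 2 := by
      have : n * ‖b n‖ = ‖(n:ℂ) * b n‖ := by simp
      rw [this, eb]; simp
    rw [mul_add]
    linarith
  · intro z hz
    have hz1 : ‖z‖ < 1 := by simpa using hz
    obtain ⟨R, hR1, hR2⟩ := exists_between hz1
    have hR0 : 0 < R := (norm_nonneg z).trans_lt hR1
    have hRc : (R:ℂ) ≠ 0 := by exact_mod_cast hR0.ne'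
    obtain ⟨q1, q2⟩ := hqc.scale hqpos R hR0.le hR2
    obtain ⟨s1, s2⟩ := hsc.scale hspos R hR0.le hR2
    set w : ℂ := z / R with hw
    have hw1 : ‖w‖ < 1 := by
      rw [hw, norm_div, Complex.norm_real, Real.norm_eq_abs, abs_of_pos hR0, div_lt_one hR0]; exact hR1
    have I1 := lemI _ s1 (by simp [hsc0]) s2 w hw1
    have I2 := lemII _ _ q1 (by simp [hqc0]) q2 s1 (by simp [hsc0]) s2 w hw1
    have hzw : ∀ n, z ^ n = (R:ℂ) ^ n * w ^ n := by
      intro n; rw [hw, div_pow]; field_simp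
    have f1 : ∀ n : ℕ, sc n * (R:ℂ) ^ n * (w ^ n / n) = sc n * (z ^ n / n) := by
      intro n; rw [hzw]; ring
    have f2 : ∀ n : ℕ, (∑ p ∈ Finset.HasAntidiagonal.antidiagonal n, qc p.1 * (R:ℂ) ^ p.1 * (sc p.2 * (R:ℂ) ^ p.2)) * (w ^ n / n)
        = (∑ p ∈ Finset.HasAntidiagonal.antidiagonal n, qc p.1 * sc p.2) * (z ^ n / n) := by
      intro n
      rw [hzw, Finset.sum_mul, Finset.sum_mul]
      refine Finset.sum_congr rfl fun p hp => ?_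
      rw [← Finset.HasAntidiagonal.mem_antidiagonal.1 hp]; ring
    simp_rw [f1] at I1
    simp_rw [f2] at I2
    have S1 := hsc.summ_div hz
    have S2 := (hqc.mul hsc).summ_div hz
    have key : ∑' n, (a n + b n) * z ^ n = (((1 - α : ℝ)) : ℂ) * (∑' n : ℕ, (∑ p ∈ Finset.HasAntidiagonal.antidiagonal n, qc p.1 * sc p.2) * (z ^ n / n))
        + ((α : ℝ) : ℂ) * ∑' n : ℕ, sc n * (z ^ n / n) := by
      rw [← tsum_mul_left, ← tsum_mul_left, ← (S2.mul_left _).tsum_add (S1.mul_left _)]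
      congr 1; ext n
      by_cases hn : n = 0
      · subst hn; simp [ha0, hb0]
      · have e := E2' n hn
        have hnc : (n:ℂ) ≠ 0 := by exact_mod_cast hn
        have e3 : ∑ p ∈ Finset.HasAntidiagonal.antidiagonal n, pc p.1 * sc p.2
            = α * sc n + (1 - α) * ∑ p ∈ Finset.HasAntidiagonal.antidiagonal n, qc p.1 * sc p.2 := by
          simp only [hpc, add_mul, Finset.sum_add_distrib]
          congr 1
          · rw [Finset.Nat.sum_antidiagonal_eq_sum_range_succ (fun i j => (if i = 0 then (α:ℂ) else 0) * sc j),
              Finset.sum_eq_single 0]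
            · simp
            · intro i _ hi; simp [hi]
            · simp
          · rw [Finset.mul_sum]; exact Finset.sum_congr rfl fun _ _ => by ring
        rw [e3] at e
        push_cast
        field_simp
        linear_combination z ^ n * e
    rw [key, Complex.add_re, Complex.re_ofReal_mul, Complex.re_ofReal_mul]
    nlinarith

lemma logd (h : ℂ → ℂ) (a : ℕ → ℂ)
    (hha : ∀ z ∈ ball (0:ℂ) 1, ∃ w : ℂ, HasSum (fun n => a n * z ^ n) w ∧ h z = Complex.exp w) :
    PS (fun z => z * deriv h z / h z) (fun n => n * a n) ∧
    PS (fun z => ∑' n, a n * z ^ n) a ∧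
    ∀ z ∈ ball (0:ℂ) 1, h z = Complex.exp (∑' n, a n * z ^ n) := by
  have hW : PS (fun z => ∑' n, a n * z ^ n) a := by
    intro z hz
    obtain ⟨w, hw, _⟩ := hha z hz
    exact hw.summable.hasSum
  have he : ∀ z ∈ ball (0:ℂ) 1, h z = Complex.exp (∑' n, a n * z ^ n) := by
    intro z hz
    obtain ⟨w, hw, e⟩ := hha z hz
    rw [e, hw.tsum_eq]
  refine ⟨?_, hW, he⟩
  intro z hz
  have hz' := isOpen_ball.mem_nhds hz
  have hd := (hW.zderiv.1.differentiableAt hz').hasDerivAt.cexp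
  have hev : h =ᶠ[nhds z] fun z => Complex.exp (∑' n, a n * z ^ n) :=
    Filter.eventuallyEq_of_mem hz' he
  have e1 : z * deriv h z / h z = z * deriv (fun z => ∑' n, a n * z ^ n) z := by
    rw [hev.deriv_eq, hd.deriv, he z hz]
    have := Complex.exp_ne_zero (∑' n, a n * z ^ n)
    field_simp
  have := hW.zderiv.2 z hz
  simp only at this
  rw [← e1] at this; exact this

lemma topo (f : ℂ → ℂ) (m : ℝ) (hopen : ∀ z ∈ ball (0:ℂ) 1, Filter.map f (nhds z) = nhds (f z))
    (hinj : Set.InjOn f (ball 0 1)) (hlow : ∀ z ∈ ball (0:ℂ) 1, m * ‖z‖ ≤ ‖f z‖)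
    (hup : ∀ ρ : ℝ, 0 < ρ → ρ < 1 → ∃ z : ℂ, ‖z‖ = ρ ∧ ‖f z‖ ≤ 1) :
    m ≤ infDist 0 (frontier (f '' ball 0 1)) := by
  have hV : IsOpen (f '' ball 0 1) := by
    rw [isOpen_iff_mem_nhds]
    rintro _ ⟨z, hz, rfl⟩
    rw [← hopen z hz]
    exact Filter.image_mem_map (isOpen_ball.mem_nhds hz)
  have hcont : ∀ z ∈ ball (0:ℂ) 1, ContinuousAt f z := fun z hz => (hopen z hz).le
  have hne : (frontier (f '' ball (0:ℂ) 1)).Nonempty := by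
    rw [Set.nonempty_iff_ne_empty]
    intro hemp
    have hcl : IsClopen (f '' ball (0:ℂ) 1) := isClopen_iff_frontier_eq_empty.2 hemp
    have huniv : f '' ball (0:ℂ) 1 = Set.univ :=
      hcl.eq_univ ⟨f 0, 0, by simp, rfl⟩
    have hρ : ∀ n : ℕ, ∃ z : ℂ, ‖z‖ = 1 - 1 / ((n:ℝ) + 2) ∧ ‖f z‖ ≤ 1 := by
      intro n
      have h2 : (0:ℝ) < (n:ℝ) + 2 := by positivity
      apply hup
      · rw [sub_pos, div_lt_one h2]; have : (0:ℝ) ≤ n := by positivity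
        linarith
      · have : 0 < 1 / ((n:ℝ) + 2) := by positivity
        linarith
    choose Z hZ1 hZ2 using hρ
    obtain ⟨w, _, φ, hφ, hlim⟩ := (isCompact_closedBall (0:ℂ) 1).tendsto_subseq (x := fun n => f (Z n))
      (fun n => by simpa using hZ2 n)
    obtain ⟨z, hz, hzw⟩ : w ∈ f '' ball (0:ℂ) 1 := by rw [huniv]; trivial
    have hz1 : ‖z‖ < 1 := by simpa using hz
    obtain ⟨R, hR1, hR2⟩ := exists_between hz1
    have hnb : f '' ball 0 R ∈ nhds w := by
      rw [← hzw, ← hopen z hz]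
      exact Filter.image_mem_map (isOpen_ball.mem_nhds (by simpa using hR1))
    have ev1 := hlim.eventually hnb
    have ht : Filter.Tendsto (fun n : ℕ => 1 - 1 / ((n:ℝ) + 2)) Filter.atTop (nhds (1 - 0)) := by
      apply Filter.Tendsto.const_sub
      have := (tendsto_const_div_atTop_nhds_zero_nat (1:ℝ)).comp (Filter.tendsto_add_atTop_nat 2)
      refine this.congr fun n => ?_
      simp
    have ev2 := ((ht.comp hφ.tendsto_atTop).eventually (lt_mem_nhds (show R < 1 - 0 by simpa using hR2)))
    obtain ⟨n, hn1, hn2⟩ := (ev1.and ev2).exists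
    obtain ⟨y, hy, hfy⟩ := hn1
    have hyn : ‖y‖ < R := by simpa using hy
    simp only [Function.comp] at hfy hn2
    have hZb : Z (φ n) ∈ ball (0:ℂ) 1 := by
      simp only [mem_ball_zero_iff, hZ1]
      have : 0 < 1 / ((φ n:ℝ) + 2) := by positivity
      linarith
    have := hinj (ball_subset_ball hR2.le hy) hZb hfy
    rw [this, hZ1] at hyn
    linarith
  rw [le_infDist hne]
  intro w hw
  rw [hV.frontier_eq] at hw
  obtain ⟨hw1, hw2⟩ := hw
  rw [mem_closure_iff_seq_limit] at hw1
  obtain ⟨x, hx, hxl⟩ := hw1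
  choose Z hZb hZf using hx
  obtain ⟨z, hz, φ, hφ, hlim⟩ := (isCompact_closedBall (0:ℂ) 1).tendsto_subseq (x := Z)
      (fun n => ball_subset_closedBall (hZb n))
  have hxl' := hxl.comp hφ.tendsto_atTop
  have hz1 : ‖z‖ = 1 := by
    by_contra hne1
    have hzb : z ∈ ball (0:ℂ) 1 := by
      have : ‖z‖ ≤ 1 := by simpa using hz
      simpa using lt_of_le_of_ne this hne1
    apply hw2
    refine ⟨z, hzb, ?_⟩
    refine tendsto_nhds_unique ((hcont z hzb).tendsto.comp hlim) ?_
    refine hxl'.congr fun n => ?_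
    simp [hZf]
  have l1 : Filter.Tendsto (fun n => m * ‖Z (φ n)‖) Filter.atTop (nhds (m * 1)) := by
    rw [← hz1]; exact (hlim.norm).const_mul m
  have l2 := hxl'.norm
  rw [dist_zero_left]
  rw [mul_one] at l1
  refine le_of_tendsto_of_tendsto' l1 l2 fun n => ?_
  simp only [Function.comp]
  rw [← hZf]; exact hlow _ (hZb _)

lemma open_pt (h g : ℂ → ℂ) (hh : DifferentiableOn ℂ h (ball 0 1))
    (hg : DifferentiableOn ℂ g (ball 0 1))
    (hhne : ∀ z ∈ ball (0:ℂ) 1, h z ≠ 0)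
    (hgne : ∀ z ∈ ball (0:ℂ) 1, g z ≠ 0)
    (hsp : ∀ z ∈ ball (0:ℂ) 1,
      ‖z * deriv g z / g z‖ < ‖1 + z * deriv h z / h z‖) (z : ℂ) (hz : z ∈ ball (0:ℂ) 1) :
    Filter.map (fun z => z * h z * (starRingEnd ℂ) (g z)) (nhds z) = nhds (z * h z * (starRingEnd ℂ) (g z)) := by
  have hz' := isOpen_ball.mem_nhds hz
  have h1 : HasStrictDerivAt h (deriv h z) z := (hh.analyticAt hz').hasStrictDerivAt
  have h2 : HasStrictDerivAt g (deriv g z) z := (hg.analyticAt hz').hasStrictDerivAt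
  have h3 : HasStrictDerivAt (fun z => z * h z) (1 * h z + z * deriv h z) z := (hasStrictDerivAt_id z).mul h1
  have h4 : HasStrictFDerivAt (𝕜 := ℝ) (fun z => z * h z) _ z := h3.hasStrictFDerivAt.restrictScalars ℝ
  have h5 : HasStrictFDerivAt (𝕜 := ℝ) g _ z := h2.hasStrictFDerivAt.restrictScalars ℝ
  have h6 : HasStrictFDerivAt (𝕜 := ℝ) (fun z => (starRingEnd ℂ) (g z)) _ z :=
    (Complex.conjCLE : ℂ →L[ℝ] ℂ).hasStrictFDerivAt.comp z h5
  have h7 := h4.mul h6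
  refine h7.map_nhds_eq_of_surj ?_
  rw [LinearMap.range_eq_top]
  rw [← LinearMap.injective_iff_surjective]
  rw [injective_iff_map_eq_zero]
  intro w hw
  by_contra hw0
  simp at hw
  have hH := hhne z hz
  have hG := hgne z hz
  have hn : ‖z * h z * ((starRingEnd ℂ) w * (starRingEnd ℂ) (deriv g z))‖ = ‖(starRingEnd ℂ) (g z) * (w * (h z + z * deriv h z))‖ := by
    rw [eq_neg_of_add_eq_zero_left hw, norm_neg]
  have hs := hsp z hz
  have e1 : ‖z * h z * ((starRingEnd ℂ) w * (starRingEnd ℂ) (deriv g z))‖ = ‖z * deriv g z / g z‖ * (‖h z‖ * ‖g z‖ * ‖w‖) := by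
    have : ‖g z‖ ≠ 0 := by simpa using hG
    simp only [norm_mul, norm_div, RCLike.norm_conj]; field_simp
  have e2 : ‖(starRingEnd ℂ) (g z) * (w * (h z + z * deriv h z))‖ = ‖1 + z * deriv h z / h z‖ * (‖h z‖ * ‖g z‖ * ‖w‖) := by
    have : h z + z * deriv h z = (1 + z * deriv h z / h z) * h z := by field_simp
    rw [this]
    simp only [norm_mul, RCLike.norm_conj]; ring
  rw [e1, e2] at hn
  have hpos : 0 < ‖h z‖ * ‖g z‖ * ‖w‖ := by
    have := norm_pos_iff.2 hH
    have := norm_pos_iff.2 hG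
    have := norm_pos_iff.2 hw0
    positivity
  have := mul_lt_mul_of_pos_right hs hpos
  linarith

lemma up_pt (h g : ℂ → ℂ) (hh : DifferentiableOn ℂ h (ball 0 1))
    (hg : DifferentiableOn ℂ g (ball 0 1)) (hh0 : h 0 = 1) (hg0 : g 0 = 1)
    (hhne : ∀ z ∈ ball (0:ℂ) 1, h z ≠ 0)
    (hgne : ∀ z ∈ ball (0:ℂ) 1, g z ≠ 0) (ρ : ℝ) (h0 : 0 < ρ) (h1 : ρ < 1) :
    ∃ z : ℂ, ‖z‖ = ρ ∧ ‖z * h z * (starRingEnd ℂ) (g z)‖ ≤ 1 := by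
  have hsub : closedBall (0:ℂ) ρ ⊆ ball 0 1 := closedBall_subset_ball h1
  have hd : DifferentiableOn ℂ (fun z => (h z * g z)⁻¹) (ball 0 1) :=
    (hh.mul hg).inv (fun z hz => mul_ne_zero (hhne z hz) (hgne z hz))
  have hdc : DiffContOnCl ℂ (fun z => (h z * g z)⁻¹) (ball 0 ρ) := by
    apply DifferentiableOn.diffContOnCl
    rw [closure_ball _ h0.ne']
    exact hd.mono hsub
  obtain ⟨z, hz, hmax⟩ := Complex.exists_mem_frontier_isMaxOn_norm isBounded_ball (nonempty_ball.2 h0) hdc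
  rw [frontier_ball _ h0.ne'] at hz
  have hzn : ‖z‖ = ρ := by simpa using hz
  refine ⟨z, hzn, ?_⟩
  have h2 := hmax (show (0:ℂ) ∈ closure (ball 0 ρ) from subset_closure (by simpa using h0))
  simp only [Function.comp, Set.mem_setOf_eq, hh0, hg0, norm_inv, mul_one, norm_one, inv_one] at h2
  have hzb : z ∈ ball (0:ℂ) 1 := hsub (by simp [hzn])
  have hp : 0 < ‖h z * g z‖ := norm_pos_iff.2 (mul_ne_zero (hhne z hzb) (hgne z hzb))
  have h3 : ‖h z * g z‖ ≤ 1 := by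
    rwa [le_inv_comm₀ one_pos hp, inv_one] at h2
  rw [norm_mul] at h3
  rw [norm_mul, norm_mul, RCLike.norm_conj, hzn, mul_assoc]
  have := norm_nonneg (h z); have := norm_nonneg (g z)
  nlinarith [mul_nonneg (norm_nonneg (h z)) (norm_nonneg (g z))]

lemma sum_bd (α : ℝ) (hα0 : 0 ≤ α) (hα1 : α < 1) (c : ℕ → ℝ) (hc0 : c 0 = 0) (hcn : ∀ n, 0 ≤ c n)
    (hc : ∀ n : ℕ, n ≠ 0 → n * c n ≤ 4 * (1 - α) * n + 2 * α) (r : ℝ) (hr0 : 0 ≤ r) (hr1 : r < 1) :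
    ∑' n, c n * r ^ n ≤ 4 * (1 - α) * r / (1 - r) - 2 * α * Real.log (1 - r) := by
  have g1 : HasSum (fun n : ℕ => r ^ (n+1)) (r / (1 - r)) := by
    simpa [pow_succ, div_eq_inv_mul] using (hasSum_geometric_of_lt_one hr0 hr1).mul_right r
  have g2 := Real.hasSum_pow_div_log_of_abs_lt_one (x := r) (by rwa [abs_of_nonneg hr0])
  have g3 := (g1.mul_left (4 * (1 - α))).add (g2.mul_left (2 * α))
  have hb : ∀ n : ℕ, c (n+1) * r ^ (n+1) ≤ 4 * (1 - α) * r ^ (n+1) + 2 * α * (r ^ (n+1) / (n+1)) := by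
    intro n
    have := hc (n+1) (Nat.succ_ne_zero n)
    push_cast at this
    have hn : (0:ℝ) < n + 1 := by positivity
    have h1 : c (n+1) ≤ 4 * (1 - α) + 2 * α / (n+1) := by
      rw [← mul_le_mul_iff_right₀ hn]; field_simp; linarith
    calc _ ≤ (4 * (1 - α) + 2 * α / (n+1)) * r ^ (n+1) := by gcongr
      _ = _ := by ring
  have hs : Summable fun n : ℕ => c (n+1) * r ^ (n+1) :=
    Summable.of_nonneg_of_le (fun n => mul_nonneg (hcn _) (by positivity)) hb g3.summable
  have hs' : Summable fun n : ℕ => c n * r ^ n := (summable_nat_add_iff 1).1 hs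
  rw [hs'.tsum_eq_zero_add, hc0, zero_mul, zero_add]
  refine (hs.tsum_le_tsum hb g3.summable).trans (le_of_eq ?_)
  rw [g3.tsum_eq]; ring

end Bohr

/-- Bohr-type inequality for `f(z) = z h(z) conj(g z)`: if `0 ≤ r < 1` satisfies
`(r/(1-r)^{2α}) exp(4(1-α)r/(1-r)) ≤ 1/(2^{2α} e^{2(1-α)})`, then
`r exp(Σ_{n≥1} (|aₙ|+|bₙ|) rⁿ) ≤ d(0, ∂ f(𝔻))`. -/
theorem stmt_9 (α : ℝ) (hα0 : 0 ≤ α) (hα1 : α < 1)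
    (h g : ℂ → ℂ)
    (hh : DifferentiableOn ℂ h (ball 0 1))
    (hg : DifferentiableOn ℂ g (ball 0 1))
    (hh0 : h 0 = 1) (hg0 : g 0 = 1)
    (hhne : ∀ z ∈ ball (0:ℂ) 1, h z ≠ 0)
    (hgne : ∀ z ∈ ball (0:ℂ) 1, g z ≠ 0)
    (hsp : ∀ z ∈ ball (0:ℂ) 1,
      ‖z * deriv g z / g z‖ < ‖1 + z * deriv h z / h z‖)
    (hinj : Set.InjOn (fun z => z * h z * (starRingEnd ℂ) (g z)) (ball 0 1))
    (hstar : ∀ z ∈ ball (0:ℂ) 1, z ≠ 0 →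
      α < (1 + z * deriv h z / h z - (starRingEnd ℂ) (z * deriv g z / g z)).re)
    (a : ℕ → ℂ) (ha0 : a 0 = 0)
    (hha : ∀ z ∈ ball (0:ℂ) 1, ∃ w : ℂ,
      HasSum (fun n => a n * z ^ n) w ∧ h z = Complex.exp w)
    (b : ℕ → ℂ) (hb0 : b 0 = 0)
    (hgb : ∀ z ∈ ball (0:ℂ) 1, ∃ w : ℂ,
      HasSum (fun n => b n * z ^ n) w ∧ g z = Complex.exp w)
    (r : ℝ) (hr0 : 0 ≤ r) (hr1 : r < 1)
    (hrle : r / (1 - r) ^ (2 * α) * Real.exp (4 * (1 - α) * r / (1 - r)) ≤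
      1 / ((2:ℝ) ^ (2 * α) * Real.exp (2 * (1 - α)))) :
    r * Real.exp (∑' n : ℕ, (‖a n‖ + ‖b n‖) * r ^ n) ≤
      infDist 0 (frontier ((fun z => z * h z * (starRingEnd ℂ) (g z)) '' ball 0 1)) := by
  have hA := Bohr.logd h a hha
  have hB := Bohr.logd g b hgb
  obtain ⟨c1, c2⟩ := Bohr.core α hα0 hα1 _ _ a b ha0 hb0 hA.1 hB.1 hsp (by
    intro z hz
    by_cases h0 : z = 0
    · subst h0; simpa using hα1
    · have := hstar z hz h0
      simpa only [Complex.sub_re, Complex.conj_re] using this)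
  set m : ℝ := 1 / ((2:ℝ) ^ (2 * α) * Real.exp (2 * (1 - α))) with hm
  have hm2 : m = Real.exp (-2 * (1 - α) - 2 * α * Real.log 2) := by
    rw [hm, Real.rpow_def_of_pos two_pos, ← Real.exp_add, one_div, ← Real.exp_neg]
    congr 1; ring
  have hmain := Bohr.topo (fun z => z * h z * (starRingEnd ℂ) (g z)) m
    (fun z hz => Bohr.open_pt h g hh hg hhne hgne hsp z hz) hinj (by
      intro z hz
      have e : ‖h z‖ * ‖g z‖ = Real.exp (∑' n, (a n + b n) * z ^ n).re := by
        rw [hA.2.2 z hz, hB.2.2 z hz, ← norm_mul, ← Complex.exp_add, Complex.norm_exp]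
        congr 2
        rw [← ((hA.2.1 z hz).summable).tsum_add ((hB.2.1 z hz).summable)]
        congr 1; ext n; ring
      simp only [norm_mul, RCLike.norm_conj]
      rw [mul_assoc, e, hm2, mul_comm]
      gcongr
      exact c2 z hz)
    (fun ρ h0 h1 => Bohr.up_pt h g hh hg hh0 hg0 hhne hgne ρ h0 h1)
  refine le_trans ?_ hmain
  refine le_trans ?_ hrle
  have hs := Bohr.sum_bd α hα0 hα1 (fun n => ‖a n‖ + ‖b n‖) (by simp [ha0, hb0]) (fun n => by positivity) c1 r hr0 hr1
  have h1r : 0 < 1 - r := by linarith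
  calc r * Real.exp (∑' n : ℕ, (‖a n‖ + ‖b n‖) * r ^ n)
      ≤ r * Real.exp (4 * (1 - α) * r / (1 - r) - 2 * α * Real.log (1 - r)) := by gcongr
    _ = _ := by
      rw [Real.rpow_def_of_pos h1r, Real.exp_sub]
      rw [show Real.log (1 - r) * (2 * α) = 2 * α * Real.log (1 - r) by ring]
      ring
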